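/- Let K be a compact metrizable group and Γ a group of continuous automorphisms of K. Suppose Γ₁ and Γ₂ are subgroups of Γ such that Γ₂ is a normal subgroup of Γ, Γ₂ is compact in the group of continuous automorphisms of K equipped with the compact-open topology, and Γ = Γ₁Γ₂. Then: (i) for every irreducible finite-dimensional unitary representation π of K, the orbit Γ₂[π] of the equivalence class [π] under the dual action of Γ₂ is finite; (ii) Γ is ergodic on K if and only if Γ₁ is ergodic on K. -/

import Mathlib

open MeasureTheory Topology Set Pointwise

set_option linter.unusedVariables false

namespace ErgZd

variable {K : Type*}

/-- The group of bi-continuous automorphisms of a topological group,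
as a subgroup of `MulAut K`. -/
def ContAut (K : Type*) [Group K] [TopologicalSpace K] : Subgroup (MulAut K) where
  carrier := {α | Continuous α ∧ Continuous α.symm}
  one_mem' := ⟨continuous_id, continuous_id⟩
  mul_mem' := fun {a b} ha hb => ⟨ha.1.comp hb.1, hb.2.comp ha.2⟩
  inv_mem' := fun {a} ha => ⟨ha.2, ha.1⟩

section Defs

variable [Group K] [TopologicalSpace K]

lemma ContAut.continuous (α : ↥(ContAut K)) : Continuous ⇑(α : MulAut K) := α.2.1

lemma ContAut.continuous_symm (α : ↥(ContAut K)) :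
    Continuous ⇑(α : MulAut K).symm := α.2.2

/-- Ergodicity of the action of a set `S` of automorphisms with respect to `μ`:
every invariant Borel set is null or conull. -/
def ErgSet [MeasurableSpace K] (μ : Measure K) (S : Set ↥(ContAut K)) : Prop :=
  ∀ A : Set K, MeasurableSet A → (∀ α ∈ S, (α : MulAut K) '' A = A) → μ A = 0 ∨ μ A = 1

/-- Ergodicity of a single automorphism: ergodicity of the group of its integer powers. -/
def ErgAut [MeasurableSpace K] (μ : Measure K) (α : ↥(ContAut K)) : Prop :=
  ErgSet μ (Set.range fun n : ℤ => α ^ n)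

/-- Distality of the action of a set of automorphisms: for `x ≠ 1`, the identity is
not in the closure of the orbit of `x`. -/
def DistalSet (S : Set ↥(ContAut K)) : Prop :=
  ∀ x : K, x ≠ 1 → (1 : K) ∉ closure ((fun α : ↥(ContAut K) => (α : MulAut K) x) '' S)

/-- Distality of a single automorphism. -/
def DistalAut (α : ↥(ContAut K)) : Prop := DistalSet (Set.range fun n : ℤ => α ^ n)

/-- The descending chain condition for an action: every decreasing
sequence of closed invariant subgroups is eventually constant. -/
def HasDCC (S : Set ↥(ContAut K)) : Prop :=
  ∀ C : ℕ → Subgroup K, (∀ n, IsClosed (C n : Set K)) → (∀ n, C (n + 1) ≤ C n) →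
    (∀ n, ∀ α ∈ S, ∀ x, x ∈ C n ↔ (α : MulAut K) x ∈ C n) → ∃ N, ∀ n, N ≤ n → C n = C N

/-- Restriction of an automorphism to an invariant subgroup. -/
def restrictAut (H : Subgroup K) (α : ↥(ContAut K))
    (h : ∀ x, x ∈ H ↔ (α : MulAut K) x ∈ H) : ↥(ContAut ↥H) := by
  refine ⟨⟨⟨fun x => ⟨(α : MulAut K) x, (h x).mp x.2⟩,
      fun x => ⟨(α : MulAut K).symm x, (h _).mpr (by simpa using x.2)⟩, ?_, ?_⟩, ?_⟩, ?_, ?_⟩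
  · intro x; ext; simp
  · intro x; ext; simp
  · intro x y; ext; simp
  · exact Continuous.subtype_mk ((ContAut.continuous α).comp continuous_subtype_val) _
  · exact Continuous.subtype_mk ((ContAut.continuous_symm α).comp continuous_subtype_val) _

@[simp] lemma restrictAut_coe (H : Subgroup K) (α : ↥(ContAut K))
    (h : ∀ x, x ∈ H ↔ (α : MulAut K) x ∈ H) (x : ↥H) :
    ((((restrictAut H α h) : MulAut ↥H) x : ↥H) : K) = (α : MulAut K) (x : K) := rfl

/-- The automorphism induced on the quotient by an invariant closed normal subgroup. -/
def quotAut (N : Subgroup K) [N.Normal] (α : ↥(ContAut K))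
    (h : ∀ x, x ∈ N ↔ (α : MulAut K) x ∈ N) : ↥(ContAut (K ⧸ N)) := by
  have hmap : N.map ((α : MulAut K) : K ≃* K) = N := by
    ext y
    constructor
    · rintro ⟨x, hx, rfl⟩; exact (h x).mp hx
    · intro hy
      exact ⟨(α : MulAut K).symm y, (h _).mpr (by simpa using hy), by simp⟩
  refine ⟨QuotientGroup.congr N N ((α : MulAut K) : K ≃* K) hmap, ?_, ?_⟩
  · apply (QuotientGroup.isQuotientMap_mk N).continuous_iff.mpr
    have : ⇑(QuotientGroup.congr N N ((α : MulAut K) : K ≃* K) hmap) ∘ (QuotientGroup.mk : K → K ⧸ N)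
        = (QuotientGroup.mk : K → K ⧸ N) ∘ ⇑(α : MulAut K) := by
      funext x
      exact QuotientGroup.congr_mk N N _ hmap x
    rw [this]
    exact QuotientGroup.continuous_mk.comp (ContAut.continuous α)
  · apply (QuotientGroup.isQuotientMap_mk N).continuous_iff.mpr
    have : ⇑(QuotientGroup.congr N N ((α : MulAut K) : K ≃* K) hmap).symm ∘ (QuotientGroup.mk : K → K ⧸ N)
        = (QuotientGroup.mk : K → K ⧸ N) ∘ ⇑((α : MulAut K) : K ≃* K).symm := by
      funext x
      rfl
    rw [this]
    exact QuotientGroup.continuous_mk.comp (ContAut.continuous_symm α)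

end Defs

section Reps

variable [Group K] [TopologicalSpace K]

/-- Unitary equivalence (unitary conjugacy) of `n`-dimensional unitary representations. -/
def URepEquiv {n : ℕ} (π ρ : K →* Matrix.unitaryGroup (Fin n) ℂ) : Prop :=
  ∃ U : Matrix.unitaryGroup (Fin n) ℂ, ∀ x : K,
    (U : Matrix (Fin n) (Fin n) ℂ) * (π x : Matrix (Fin n) (Fin n) ℂ)
      = (ρ x : Matrix (Fin n) (Fin n) ℂ) * (U : Matrix (Fin n) (Fin n) ℂ)

/-- The dual action of an automorphism on representations: `(α • π) x = π (α⁻¹ x)`. -/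
def dualRep {n : ℕ} (α : ↥(ContAut K)) (π : K →* Matrix.unitaryGroup (Fin n) ℂ) :
    K →* Matrix.unitaryGroup (Fin n) ℂ :=
  π.comp (((α : MulAut K).symm : K ≃* K) : K →* K)

/-- The orbit of the equivalence class `[π]` under the dual action of a set `S`
of automorphisms, as a set of equivalence classes. -/
def repOrbit {n : ℕ} (S : Set ↥(ContAut K)) (π : K →* Matrix.unitaryGroup (Fin n) ℂ) :
    Set (Quot (URepEquiv (K := K) (n := n))) :=
  (fun α : ↥(ContAut K) => Quot.mk _ (dualRep α π)) '' S

/-- Irreducibility: there is no invariant subspace other than `⊥` and `⊤`. -/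
def IsIrredRep {n : ℕ} (π : K →* Matrix.unitaryGroup (Fin n) ℂ) : Prop :=
  ∀ W : Submodule ℂ (Fin n → ℂ),
    (∀ x : K, ∀ v ∈ W, (π x : Matrix (Fin n) (Fin n) ℂ).mulVec v ∈ W) → W = ⊥ ∨ W = ⊤

end Reps

section Intertwiner

variable {A : Type*} [CStarAlgebra A] [PartialOrder A] [StarOrderedRing A]

/-- Replacing an invertible intertwiner of unitaries by the unitary part of its polar
decomposition. -/
theorem exists_unitary_intertwiner {T : A} (hT : IsUnit T) :
    ∃ U ∈ unitary A, ∀ u ∈ unitary A, ∀ v ∈ unitary A, T * u = v * T → U * u = v * U := by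
  have hP : IsUnit (CFC.abs T) := by
    have h : IsUnit (CFC.abs T * CFC.abs T) := by
      rw [CFC.abs_mul_abs]; exact hT.star.mul hT
    exact ((Commute.refl _).isUnit_mul_iff.mp h).1
  obtain ⟨P, hP⟩ := hP
  have hPP : (P : A) * P = star T * T := by rw [hP, CFC.abs_mul_abs]
  have hPs : star (P : A) = P := by
    rw [hP]; exact (CFC.abs_nonneg T).isSelfAdjoint
  have hPis : star (↑P⁻¹ : A) = ↑P⁻¹ := by
    rw [← Units.coe_star_inv]
    congr 2
    ext; simpa using hPs
  refine ⟨T * ↑P⁻¹, ?_, ?_⟩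
  · have hu : IsUnit (T * (↑P⁻¹ : A)) := hT.mul (Units.isUnit _)
    rw [Unitary.mem_iff]
    have h1 : star (T * (↑P⁻¹ : A)) * (T * ↑P⁻¹) = 1 := by
      rw [star_mul, hPis, mul_assoc, ← mul_assoc (star T), ← hPP]
      simp
    exact ⟨h1, hu.mul_left_injective (by simp only [mul_assoc, h1, mul_one, one_mul])⟩
  · intro u hu v hv h
    have h2 : star T * v = u * star T := by
      have := congrArg star h
      simp only [star_mul] at this
      calc star T * v = u * (star u * star T) * v := by
            rw [← mul_assoc u, Unitary.mul_star_self_of_mem hu, one_mul]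
        _ = u * star T := by
            rw [this, mul_assoc, mul_assoc, Unitary.star_mul_self_of_mem hv, mul_one]
    have hc : Commute (star T * T) u := by
      rw [Commute, SemiconjBy, mul_assoc, h, ← mul_assoc, h2, mul_assoc]
    have hc2 : Commute (P : A) u := by
      rw [hP]
      exact hc.cfcₙ_nnreal _
    rw [mul_assoc, (hc2.units_inv_left).eq, ← mul_assoc, h, mul_assoc]

end Intertwiner

section CloseRepresentations

variable {A : Type*} [Group K] [TopologicalSpace K] [IsTopologicalGroup K]
  [CompactSpace K] [MeasurableSpace K] [BorelSpace K] [CStarAlgebra A]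

/-- Uniformly close unitary representations of a compact group are intertwined by an invertible
element. -/
theorem exists_isUnit_intertwiner [SecondCountableTopology K]
    (μ : Measure K) [μ.IsMulLeftInvariant] [IsProbabilityMeasure μ]
    (π ρ : K →* unitary A) (hπ : Continuous π) (hρ : Continuous ρ)
    (h : ∀ x, ‖(π x : A) - ρ x‖ ≤ 1 / 2) :
    ∃ T : A, IsUnit T ∧ ∀ y, T * π y = ρ y * T := by
  set F : K → A := fun x => ρ x * star (π x : A) with hF
  have hFc : Continuous F := (continuous_subtype_val.comp hρ).mul
    (continuous_subtype_val.comp hπ).star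
  have hFi : Integrable F μ := hFc.integrable_of_hasCompactSupport
    (HasCompactSupport.of_compactSpace F)
  refine ⟨∫ x, F x ∂μ, ?_, fun y => ?_⟩
  · have hn : ‖1 - ∫ x, F x ∂μ‖ < 1 := by
      have : 1 - ∫ x, F x ∂μ = ∫ x, (1 - F x) ∂μ := by
        rw [integral_sub (integrable_const _) hFi]; simp
      rw [this]
      refine (norm_integral_le_of_norm_le_const (C := 1 / 2) (.of_forall fun x => ?_)).trans_lt ?_
      · have : 1 - F x = ((π x : A) - ρ x) * star (π x : A) := by
          rw [sub_mul, Unitary.mul_star_self_of_mem (π x).2]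
        rw [this, ← Unitary.coe_star, CStarRing.norm_mul_coe_unitary]
        exact h x
      · simp; norm_num
    have := isUnit_one_sub_of_norm_lt_one hn
    simpa using this
  · have e1 : (∫ x, F x ∂μ) * π y = ∫ x, F x * π y ∂μ :=
      (integral_mul_const_of_integrable hFi).symm
    have e2 : (ρ y : A) * ∫ x, F x ∂μ = ∫ x, ρ y * F x ∂μ :=
      (integral_const_mul_of_integrable hFi).symm
    rw [e1, e2, ← integral_mul_left_eq_self (fun x => F x * (π y : A)) y]
    congr 1
    funext x
    simp only [hF, map_mul, Submonoid.coe_mul, star_mul]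
    simp only [mul_assoc, Unitary.coe_star_mul_self, mul_one]

end CloseRepresentations

section FiniteOrbit

variable [Group K] [TopologicalSpace K] [IsTopologicalGroup K]
  [CompactSpace K] [SecondCountableTopology K] [MeasurableSpace K] [BorelSpace K]

open scoped Matrix.Norms.L2Operator MatrixOrder ComplexOrder

theorem urepEquiv_of_norm_sub_le
    (μ : Measure K) [μ.IsMulLeftInvariant] [IsProbabilityMeasure μ] {n : ℕ}
    {π ρ : K →* Matrix.unitaryGroup (Fin n) ℂ} (hπ : Continuous π) (hρ : Continuous ρ)
    (h : ∀ x, ‖(π x : Matrix (Fin n) (Fin n) ℂ) - ρ x‖ ≤ 1 / 2) : URepEquiv π ρ := by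
  obtain ⟨T, hT, hTi⟩ := exists_isUnit_intertwiner μ π ρ hπ hρ h
  obtain ⟨U, hU, hUi⟩ := exists_unitary_intertwiner hT
  exact ⟨⟨U, hU⟩, fun x => hUi _ (π x).2 _ (ρ x).2 (hTi x)⟩

/-- A compact group of automorphisms has finite orbits on classes of representations. -/
theorem finite_repOrbit
    (μ : Measure K) [μ.IsMulLeftInvariant] [IsProbabilityMeasure μ] (Γ : Subgroup ↥(ContAut K))
    (hcompact : IsCompact ((fun α : ↥(ContAut K) =>
      (⟨⇑(α : MulAut K), ContAut.continuous α⟩ : C(K, K))) '' (Γ : Set ↥(ContAut K))))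
    {n : ℕ} {π : K →* Matrix.unitaryGroup (Fin n) ℂ} (hπ : Continuous π) :
    (repOrbit (Γ : Set ↥(ContAut K)) π).Finite := by
  let πc : C(K, Matrix (Fin n) (Fin n) ℂ) := ⟨fun x => π x, continuous_subtype_val.comp hπ⟩
  have hD := hcompact.image (ContinuousMap.continuous_postcomp πc)
  obtain ⟨t, -, ht, hcover⟩ := hD.finite_cover_balls (e := 1 / 4) (by norm_num)
  let toMap : ↥(ContAut K) → C(K, Matrix (Fin n) (Fin n) ℂ) := fun α =>
    πc.comp ⟨⇑((α⁻¹ : ↥(ContAut K)) : MulAut K), ContAut.continuous α⁻¹⟩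
  have hdual : ∀ α, Continuous (dualRep α π) := fun α => hπ.comp (ContAut.continuous_symm α)
  refine (ht.biUnion (t := fun φ => {q | ∃ α ∈ Γ, dist (toMap α) φ < 1 / 4 ∧
    Quot.mk _ (dualRep α π) = q}) fun φ _ => Set.Subsingleton.finite ?_).subset ?_
  · rintro _ ⟨α, -, hα, rfl⟩ _ ⟨β, -, hβ, rfl⟩
    refine Quot.sound (urepEquiv_of_norm_sub_le μ (hdual α) (hdual β) fun x => ?_)
    rw [← dist_eq_norm]
    refine (ContinuousMap.dist_apply_le_dist (f := toMap α) (g := toMap β) x).trans ?_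
    have := dist_triangle_right (toMap α) (toMap β) φ
    linarith
  · rintro _ ⟨α, hα, rfl⟩
    have := hcover ⟨_, ⟨α⁻¹, Γ.inv_mem hα, rfl⟩, rfl⟩
    simp only [Set.mem_iUnion, Metric.mem_ball] at this
    obtain ⟨φ, hφ, hd⟩ := this
    exact Set.mem_biUnion hφ ⟨α, hα, hd, rfl⟩

end FiniteOrbit

section Hilbert

open scoped InnerProductSpace

variable {H : Type*} [NormedAddCommGroup H] [InnerProductSpace ℂ H]

/-- The restriction of a representation by linear isometries to a finite-dimensional invariant
subspace, written in an orthonormal basis. -/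
theorem exists_unitaryGroup_rep_of_invariant [Group K] [TopologicalSpace K]
    (L : K →* (H →ₗᵢ[ℂ] H)) (hL : ∀ v, Continuous fun x => L x v)
    (V : Submodule ℂ H) [FiniteDimensional ℂ V] (hV : ∀ x, ∀ v ∈ V, L x v ∈ V) :
    ∃ (n : ℕ) (π : K →* Matrix.unitaryGroup (Fin n) ℂ), Continuous π ∧
      (∀ x, π x = 1 → ∀ v ∈ V, L x v = v) ∧
      ∀ U : H →ₗᵢ[ℂ] H, (∀ v ∈ V, U v ∈ V) → ∀ x y, (∀ v, U (L x v) = L y (U v)) →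
        (π x : Matrix (Fin n) (Fin n) ℂ).trace = (π y : Matrix (Fin n) (Fin n) ℂ).trace := by
  let b := stdOrthonormalBasis ℂ V
  let R : K →* (V →ₗ[ℂ] V) :=
    { toFun := fun x => (L x).toLinearMap.restrict (hV x)
      map_one' := by ext v; simp
      map_mul' := fun x y => by ext v; simp }
  have hR : ∀ x (v : V), (R x v : H) = L x v := fun x v => rfl
  have hLinv : ∀ x v, L x (L x⁻¹ v) = v := fun x v => by
    have := DFunLike.congr_fun (map_mul L x x⁻¹) v
    rw [mul_inv_cancel, map_one] at this
    exact this.symm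
  have hadj : ∀ x, R x⁻¹ = star (R x) := fun x => by
    rw [LinearMap.star_eq_adjoint, LinearMap.eq_adjoint_iff]
    intro v w
    rw [Submodule.coe_inner, Submodule.coe_inner, hR, hR, ← (L x).inner_map_map, hLinv]
  have hunit : ∀ x, R x ∈ unitary (V →ₗ[ℂ] V) := fun x => by
    rw [Unitary.mem_iff, ← hadj, ← map_mul, ← map_mul]
    simp
  let e := LinearMap.toMatrixOrthonormal b
  have he : ∀ x, e (R x) ∈ unitary (Matrix _ _ ℂ) := fun x => Unitary.map_mem e (hunit x)
  let π : K →* Matrix.unitaryGroup (Fin (Module.finrank ℂ V)) ℂ :=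
    { toFun := fun x => ⟨e (R x), he x⟩
      map_one' := by ext1; simp
      map_mul' := fun x y => by ext1; simp }
  have hπ : ∀ x, (π x : Matrix _ _ ℂ) = e (R x) := fun x => rfl
  refine ⟨_, π, ?_, fun x hx v hv => ?_, fun U hU x y h => ?_⟩
  · refine Continuous.subtype_mk (continuous_matrix fun i j => ?_) _
    have : ∀ x, e (R x) i j = ⟪(b i : H), L x (b j)⟫_ℂ := fun x => by
      rw [LinearMap.toMatrixOrthonormal_apply_apply, Submodule.coe_inner, hR]
    simp only [this]
    exact continuous_const.inner (hL _)
  · have h1 : e (R x) = e 1 := by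
      rw [← hπ, hx, map_one]; rfl
    rw [← hR x ⟨v, hv⟩, e.injective h1]
    rfl
  · have htr : ∀ z, Matrix.trace (π z : Matrix (Fin (Module.finrank ℂ V)) _ ℂ) =
        LinearMap.trace ℂ V (R z) := fun z => by
      rw [hπ, LinearMap.trace_eq_matrix_trace ℂ b.toBasis]
      rfl
    let u : V →ₗ[ℂ] V := U.toLinearMap.restrict hU
    have hu : Function.Injective u := fun v w hvw =>
      Subtype.ext (U.injective (congrArg Subtype.val hvw))
    let f := LinearEquiv.ofInjectiveEndo u hu
    have hconj : f.conj (R x) = R y := by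
      ext v
      obtain ⟨w, rfl⟩ := f.surjective v
      rw [LinearEquiv.conj_apply_apply, f.symm_apply_apply]
      exact h w
    rw [htr, htr, ← hconj, LinearMap.trace_conj']

variable [CompleteSpace H]

theorem adjoint_apply_commute_of_commute_inverse (T : H →L[ℂ] H) {U U' : H →ₗᵢ[ℂ] H}
    (hU : ∀ v, U (U' v) = v) (hT : ∀ v, T (U' v) = U' (T v)) (v : H) :
    T.adjoint (U v) = U (T.adjoint v) := by
  refine ext_inner_right ℂ fun w => ?_
  rw [ContinuousLinearMap.adjoint_inner_left]
  nth_rw 1 [← hU (T w)]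
  nth_rw 2 [← hU w]
  rw [U.inner_map_map, U.inner_map_map, ContinuousLinearMap.adjoint_inner_left, hT]

/-- A nonzero compact operator `T` yields a nonzero finite-dimensional subspace,
an eigenspace of `T† T`. -/
theorem exists_eigenspace_adjoint_comp_self {T : H →L[ℂ] H} (hT : IsCompactOperator T)
    (hT0 : T ≠ 0) :
    ∃ c : ℂ, c ≠ 0 ∧ ∃ V : Submodule ℂ H, FiniteDimensional ℂ V ∧ V ≠ ⊥ ∧
      ∀ v, v ∈ V ↔ T.adjoint (T v) = c • v := by
  have hc : IsCompactOperator (T.adjoint ∘L T) := hT.clm_comp T.adjoint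
  have hs : (T.adjoint ∘L T).IsSymmetric :=
    (ContinuousLinearMap.IsPositive.adjoint_conj (ContinuousLinearMap.isPositive_one) T).isSymmetric
  have h0 : T.adjoint ∘L T ≠ 0 := fun h => hT0 <| by
    ext v
    have := ContinuousLinearMap.adjoint_inner_right T v (T v)
    rw [← ContinuousLinearMap.comp_apply, h] at this
    simpa using this.symm
  have := mt (ContinuousLinearMap.eq_zero_of_forall_hasEigenvalue_eq_zero hc hs).mp h0
  push Not at this
  obtain ⟨c, hce, hc0⟩ := this
  exact ⟨c, hc0, Module.End.eigenspace (T.adjoint ∘L T).toLinearMap c,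
    ContinuousLinearMap.finite_dimensional_eigenspace hc c hc0, hce,
    fun v => Module.End.mem_eigenspace_iff⟩

end Hilbert

section InnerOperator

open scoped InnerProductSpace

variable [TopologicalSpace K] [CompactSpace K] {H : Type*} [NormedAddCommGroup H]
  [InnerProductSpace ℂ H]

/-- The operator `g ↦ (x ↦ ⟪ψ x, g⟫)` into continuous functions. -/
noncomputable def innerOperator (ψ : C(K, H)) : H →L[ℂ] C(K, ℂ) :=
  LinearMap.mkContinuous
    { toFun := fun g => ⟨fun x => ⟪ψ x, g⟫_ℂ, ψ.continuous.inner continuous_const⟩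
      map_add' := fun g h => by ext x; simp
      map_smul' := fun c g => by ext x; simp } ‖ψ‖ fun g => by
    rw [ContinuousMap.norm_le _ (by positivity)]
    intro x
    exact (norm_inner_le_norm _ _).trans
      (mul_le_mul_of_nonneg_right (ψ.norm_coe_le_norm x) (norm_nonneg g))

@[simp]
theorem innerOperator_apply (ψ : C(K, H)) (g : H) (x : K) : innerOperator ψ g x = ⟪ψ x, g⟫_ℂ := rfl

theorem isCompactOperator_innerOperator (ψ : C(K, H)) :
    IsCompactOperator (innerOperator ψ) := by
  let e := (ContinuousMap.equivBoundedOfCompact K ℂ)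
  let B : Set (BoundedContinuousFunction K ℂ) := e '' (innerOperator ψ '' Metric.ball 0 1)
  have hB : IsCompact (closure B) := by
    refine BoundedContinuousFunction.arzela_ascoli (Metric.closedBall 0 ‖ψ‖)
      (isCompact_closedBall _ _) B ?_ ?_
    · rintro _ x ⟨_, ⟨g, hg, rfl⟩, rfl⟩
      rw [mem_closedBall_zero_iff]
      refine ((innerOperator ψ g).norm_coe_le_norm x).trans ?_
      refine ((innerOperator ψ).le_of_opNorm_le
        (LinearMap.mkContinuous_norm_le _ (norm_nonneg ψ) _) g).trans ?_
      exact mul_le_of_le_one_right (norm_nonneg _) (mem_ball_zero_iff.mp hg).le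
    · intro x₀
      rw [Metric.equicontinuousAt_iff_right]
      intro ε hε
      filter_upwards [(ψ.continuous.tendsto x₀).eventually (Metric.ball_mem_nhds _ hε)] with x hx
      rintro ⟨_, ⟨_, ⟨g, hg, rfl⟩, rfl⟩⟩
      change dist ⟪ψ x₀, g⟫_ℂ ⟪ψ x, g⟫_ℂ < ε
      rw [dist_comm, dist_eq_norm, ← inner_sub_left]
      refine (norm_inner_le_norm _ _).trans_lt ?_
      rw [← dist_eq_norm]
      exact (mul_le_of_le_one_right dist_nonneg (mem_ball_zero_iff.mp hg).le).trans_lt hx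
  rw [isCompactOperator_iff_exists_mem_nhds_image_subset_compact]
  refine ⟨_, Metric.ball_mem_nhds 0 one_pos, e.symm '' closure B,
    hB.image (ContinuousMap.isometryEquivBoundedOfCompact K ℂ).symm.continuous, ?_⟩
  intro φ hφ
  exact ⟨e φ, subset_closure ⟨φ, hφ, rfl⟩, e.symm_apply_apply φ⟩

end InnerOperator

section Translation

open scoped InnerProductSpace ENNReal

variable [MeasurableSpace K]

/-- The pullback `g ↦ g ∘ σ` on `L²` along a measure-preserving map. -/
noncomputable abbrev pullback {μ : Measure K} {σ : K → K} (hσ : MeasurePreserving σ μ μ) :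
    Lp ℂ 2 μ →ₗᵢ[ℂ] Lp ℂ 2 μ :=
  Lp.compMeasurePreservingₗᵢ ℂ σ hσ

theorem pullback_comp {μ : Measure K} {σ τ : K → K} (hσ : MeasurePreserving σ μ μ)
    (hτ : MeasurePreserving τ μ μ) (g : Lp ℂ 2 μ) :
    pullback hσ (pullback hτ g) = pullback (hτ.comp hσ) g :=
  (Lp.compMeasurePreserving_comp_apply g hτ hσ).symm

theorem pullback_congr {μ : Measure K} {σ τ : K → K} (hσ : MeasurePreserving σ μ μ)
    (hτ : MeasurePreserving τ μ μ) (h : σ = τ) (g : Lp ℂ 2 μ) :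
    pullback hσ g = pullback hτ g := by
  subst h; rfl

theorem pullback_eq_self_of_eq_id {μ : Measure K} {σ : K → K} (hσ : MeasurePreserving σ μ μ)
    (h : σ = id) (g : Lp ℂ 2 μ) : pullback hσ g = g := by
  subst h
  exact Lp.compMeasurePreserving_id_apply g

section KernelOperator

variable [TopologicalSpace K] [CompactSpace K] [BorelSpace K]

/-- The operator `g ↦ (x ↦ ⟪ψ x, g⟫)` on `L²`. -/
noncomputable def kernelOperator {μ : Measure K} [IsFiniteMeasure μ] (ψ : C(K, Lp ℂ 2 μ)) :
    Lp ℂ 2 μ →L[ℂ] Lp ℂ 2 μ :=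
  (ContinuousMap.toLp 2 μ ℂ) ∘L innerOperator ψ

theorem isCompactOperator_kernelOperator {μ : Measure K} [IsFiniteMeasure μ]
    (ψ : C(K, Lp ℂ 2 μ)) : IsCompactOperator (kernelOperator ψ) :=
  (isCompactOperator_innerOperator ψ).clm_comp (ContinuousMap.toLp 2 μ ℂ)

theorem kernelOperator_pullback {μ : Measure K} [IsFiniteMeasure μ]
    (ψ : C(K, Lp ℂ 2 μ)) {σ : K → K} (hσ : MeasurePreserving σ μ μ) (hσc : Continuous σ)
    (h : ∀ x, pullback hσ (ψ (σ x)) = ψ x) (g : Lp ℂ 2 μ) :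
    kernelOperator ψ (pullback hσ g) = pullback hσ (kernelOperator ψ g) := by
  have : innerOperator ψ (pullback hσ g) = (innerOperator ψ g).comp ⟨σ, hσc⟩ := by
    ext x
    simp only [innerOperator_apply, ContinuousMap.comp_apply, ContinuousMap.coe_mk]
    rw [← h x, LinearIsometry.inner_map_map]
  rw [kernelOperator, ContinuousLinearMap.comp_apply, this, ContinuousLinearMap.comp_apply]
  refine Lp.ext ?_
  refine (ContinuousMap.coeFn_toLp μ _).trans ?_
  refine .trans ?_ (Lp.coeFn_compMeasurePreserving _ hσ).symm
  exact (hσ.quasiMeasurePreserving.ae_eq_comp (ContinuousMap.coeFn_toLp μ (innerOperator ψ g))).symm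

end KernelOperator

variable [Group K] [TopologicalSpace K] [BorelSpace K] [IsTopologicalGroup K]

/-- The left regular representation on `L²`. -/
noncomputable def leftRegular (μ : Measure K) [μ.IsMulLeftInvariant] :
    K →* (Lp ℂ 2 μ →ₗᵢ[ℂ] Lp ℂ 2 μ) where
  toFun h := pullback (measurePreserving_mul_left μ h⁻¹)
  map_one' := by
    ext1 g
    exact pullback_eq_self_of_eq_id _ (by funext x; simp) g
  map_mul' h k := by
    ext1 g
    refine Eq.trans ?_ (pullback_comp _ _ g).symm
    exact pullback_congr _ _ (by funext x; simp [mul_assoc]) g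

theorem leftRegular_apply (μ : Measure K) [μ.IsMulLeftInvariant] (h : K) (g : Lp ℂ 2 μ) :
    leftRegular μ h g = pullback (measurePreserving_mul_left μ h⁻¹) g := rfl

theorem continuous_leftRegular [CompactSpace K] [SecondCountableTopology K] (μ : Measure K)
    [μ.IsHaarMeasure] (g : Lp ℂ 2 μ) : Continuous fun h => leftRegular μ h g := by
  have : Fact ((2 : ℝ≥0∞) ≠ ∞) := ⟨ENNReal.ofNat_ne_top⟩
  have : Continuous fun h : K => DomMulAct.mk h⁻¹ • g :=
    (DomMulAct.continuous_mk.comp continuous_inv).smul continuous_const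
  exact this

theorem ae_eq_const_of_leftRegular_eq [CompactSpace K] [SecondCountableTopology K]
    (μ : Measure K) [μ.IsHaarMeasure] {g : Lp ℂ 2 μ} (hg : ∀ h, leftRegular μ h g = g) :
    ∃ c : ℂ, g =ᵐ[μ] fun _ => c := by
  refine Filter.exists_eventuallyEq_const_of_forall_separating MeasurableSet fun U hU => ?_
  have hconst : Filter.EventuallyConst (g ⁻¹' U) (ae μ) := by
    refine aeconst_of_forall_preimage_smul_ae_eq K
      ((Lp.stronglyMeasurable g).measurable hU).nullMeasurableSet fun h => ?_
    have h1 : ⇑g ∘ (h * ·) =ᵐ[μ] g := by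
      have := Lp.coeFn_compMeasurePreserving g (measurePreserving_mul_left μ h⁻¹⁻¹)
      have h2 := hg h⁻¹
      rw [leftRegular_apply] at h2
      change (pullback (measurePreserving_mul_left μ h⁻¹⁻¹) g : K → ℂ) =ᵐ[μ] _ at this
      rw [h2, inv_inv] at this
      exact this.symm
    rw [Filter.eventuallyEq_set]
    filter_upwards [h1] with x hx
    simp only [mem_preimage, smul_eq_mul, ← hx, Function.comp_apply]
  rwa [Filter.eventuallyConst_set] at hconst

end Translation

section Characters

open scoped InnerProductSpace ENNReal

variable [Group K] [TopologicalSpace K] [IsTopologicalGroup K] [CompactSpace K]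
  [MeasurableSpace K] [BorelSpace K]

theorem ContAut.measurePreserving (μ : Measure K) [μ.IsHaarMeasure] (α : ↥(ContAut K)) :
    MeasurePreserving ⇑(α : MulAut K) μ μ :=
  MonoidHom.measurePreserving (f := ((α : MulAut K) : K →* K)) (ContAut.continuous α)
    (α : MulAut K).surjective rfl

theorem pullback_leftRegular (μ : Measure K) [μ.IsHaarMeasure] (α : ↥(ContAut K)) (x : K)
    (g : Lp ℂ 2 μ) :
    pullback (ContAut.measurePreserving μ α) (leftRegular μ ((α : MulAut K) x) g) =
      leftRegular μ x (pullback (ContAut.measurePreserving μ α) g) := by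
  rw [leftRegular_apply, leftRegular_apply, pullback_comp, pullback_comp]
  exact pullback_congr _ _ (by funext y; simp) g

/-- A nonzero vector of `L²` that is fixed by a group of automorphisms and orthogonal to the
translation-invariant vectors produces a nontrivial representation with invariant character. -/
theorem exists_rep_trace_invariant [SecondCountableTopology K] (μ : Measure K) [μ.IsHaarMeasure]
    (Γ : Subgroup ↥(ContAut K)) {Φ : Lp ℂ 2 μ} (hΦ0 : Φ ≠ 0)
    (hΦ : ∀ α ∈ Γ, pullback (ContAut.measurePreserving μ α) Φ = Φ)
    (hfix : ∀ g, (∀ h, leftRegular μ h g = g) → ⟪Φ, g⟫_ℂ = 0) :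
    ∃ (n : ℕ) (π : K →* Matrix.unitaryGroup (Fin n) ℂ), Continuous π ∧ (∃ x, π x ≠ 1) ∧
      ∀ α ∈ Γ, ∀ x, (π ((α : MulAut K) x) : Matrix (Fin n) (Fin n) ℂ).trace =
        (π x : Matrix (Fin n) (Fin n) ℂ).trace := by
  let L := leftRegular μ
  let ψ : C(K, Lp ℂ 2 μ) := ⟨fun x => L x Φ, continuous_leftRegular μ Φ⟩
  let T := kernelOperator ψ
  have hT0 : T ≠ 0 := fun h => hΦ0 <| by
    have h1 : ContinuousMap.toLp 2 μ ℂ (innerOperator ψ Φ) = 0 := DFunLike.congr_fun h Φ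
    rw [← map_zero (ContinuousMap.toLp (E := ℂ) 2 μ ℂ)] at h1
    have h2 := DFunLike.congr_fun (ContinuousMap.toLp_injective μ h1) 1
    have h3 : ψ 1 = Φ := DFunLike.congr_fun (map_one L) Φ
    rw [innerOperator_apply, h3] at h2
    exact inner_self_eq_zero.mp h2
  have hTL : ∀ h g, T (L h g) = L h (T g) := fun h g => by
    refine kernelOperator_pullback ψ _ (continuous_const_mul _) (fun x => ?_) g
    have := DFunLike.congr_fun (map_mul L h (h⁻¹ * x)) Φ
    rw [mul_inv_cancel_left] at this
    exact this.symm
  have hTU : ∀ α ∈ Γ, ∀ g, T (pullback (ContAut.measurePreserving μ α) g) =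
      pullback (ContAut.measurePreserving μ α) (T g) := fun α hα g => by
    refine kernelOperator_pullback ψ _ (ContAut.continuous α) (fun x => ?_) g
    have := pullback_leftRegular μ α x Φ
    rw [hΦ α hα] at this
    exact this
  have hLinv : ∀ h g, L h (L h⁻¹ g) = g := fun h g => by
    have := DFunLike.congr_fun (map_mul L h h⁻¹) g
    rw [mul_inv_cancel, map_one] at this
    exact this.symm
  obtain ⟨c, hc0, V, hfin, hV0, hV⟩ :=
    exists_eigenspace_adjoint_comp_self (isCompactOperator_kernelOperator ψ) hT0
  obtain ⟨n, π, hπ, hπ1, htr⟩ := exists_unitaryGroup_rep_of_invariant L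
    (continuous_leftRegular μ) V fun x v hv => by
      rw [hV] at hv ⊢
      rw [hTL, adjoint_apply_commute_of_commute_inverse _ (hLinv x) (hTL x⁻¹), hv, map_smul]
  refine ⟨n, π, hπ, ?_, fun α hα x => ?_⟩
  · by_contra! h
    obtain ⟨v, hv, hv0⟩ := V.ne_bot_iff.mp hV0
    have hvfix : ∀ h, L h v = v := fun y => hπ1 y (h y) v hv
    have hTv : T v = 0 := by
      have : innerOperator ψ v = 0 := by
        ext x
        rw [innerOperator_apply, ← hvfix x]
        change ⟪L x Φ, L x v⟫_ℂ = 0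
        rw [LinearIsometry.inner_map_map]
        exact hfix v hvfix
      change ContinuousMap.toLp 2 μ ℂ (innerOperator ψ v) = 0
      rw [this, map_zero]
    have := (hV v).mp hv
    rw [hTv, map_zero] at this
    exact (smul_ne_zero hc0 hv0) this.symm
  · refine htr (pullback (ContAut.measurePreserving μ α)) (fun v hv => ?_) _ _
      (pullback_leftRegular μ α x)
    rw [hV] at hv ⊢
    have hinv : ∀ g, pullback (ContAut.measurePreserving μ α)
        (pullback (ContAut.measurePreserving μ α⁻¹) g) = g := fun g => by
      rw [pullback_comp]
      exact pullback_eq_self_of_eq_id _ (by funext y; simp) g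
    rw [hTU α hα, adjoint_apply_commute_of_commute_inverse _ hinv (hTU α⁻¹ (Γ.inv_mem hα)), hv,
      map_smul]

/-- A failure of ergodicity of a group of automorphisms is witnessed by a nontrivial
representation with invariant character. -/
theorem exists_rep_trace_invariant_of_not_ergSet [SecondCountableTopology K] (μ : Measure K)
    [μ.IsHaarMeasure] [IsProbabilityMeasure μ] (Γ : Subgroup ↥(ContAut K))
    (hΓ : ¬ ErgSet μ (Γ : Set ↥(ContAut K))) :
    ∃ (n : ℕ) (π : K →* Matrix.unitaryGroup (Fin n) ℂ), Continuous π ∧ (∃ x, π x ≠ 1) ∧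
      ∀ α ∈ Γ, ∀ x, (π ((α : MulAut K) x) : Matrix (Fin n) (Fin n) ℂ).trace =
        (π x : Matrix (Fin n) (Fin n) ℂ).trace := by
  simp only [ErgSet, not_forall, not_or] at hΓ
  obtain ⟨A, hA, hinv, hA0, hA1⟩ := hΓ
  let f : K → ℂ := fun x => A.indicator 1 x - (μ.real A : ℂ)
  have hind : MemLp (A.indicator (1 : K → ℂ)) 2 μ := (memLp_const 1).indicator hA
  have hf : MemLp f 2 μ := hind.sub (memLp_const _)
  have hmean : ∫ x, f x ∂μ = 0 := by
    rw [integral_sub (hind.integrable (by norm_num)) (integrable_const _),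
      integral_indicator hA]
    simp
  refine exists_rep_trace_invariant μ Γ (Φ := hf.toLp f) (fun h => ?_) (fun α hα => ?_)
    (fun g hg => ?_)
  · have h1 : f =ᵐ[μ] 0 := hf.coeFn_toLp.symm.trans (by rw [h]; exact Lp.coeFn_zero _ _ _)
    obtain ⟨x, hxA, hx⟩ := ((frequently_ae_mem_iff.mpr hA0).and_eventually h1).exists
    have h2 : (1 : ℂ) - (μ.real A : ℂ) = 0 := by simpa [f, hxA] using hx
    have h3 : μ.real A = 1 := by exact_mod_cast (sub_eq_zero.mp h2).symm
    exact hA1 ((ENNReal.toReal_eq_one_iff _).mp h3)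
  · have hcomp : f ∘ ⇑(α : MulAut K) = f := by
      funext x
      have hx : (α : MulAut K) x ∈ A ↔ x ∈ A := by
        conv_lhs => rw [← hinv α hα]
        exact (α : MulAut K).injective.mem_set_image
      by_cases h : x ∈ A <;> simp [f, hx, h]
    have := Lp.toLp_compMeasurePreserving hf (ContAut.measurePreserving μ α)
    refine this.trans ?_
    congr 1
  · obtain ⟨c, hc⟩ := ae_eq_const_of_leftRegular_eq μ hg
    rw [L2.inner_def]
    have : ∀ᵐ x ∂μ, ⟪hf.toLp f x, g x⟫_ℂ = f x * c := by
      filter_upwards [hf.coeFn_toLp, hc] with x h1 h2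
      rw [h1, h2]
      by_cases h : x ∈ A <;> simp [f, h, mul_comm]
    rw [integral_congr_ae this, integral_mul_const, hmean, zero_mul]

end Characters

section Ergodicity

open scoped Matrix ComplexOrder

theorem trace_conjTranspose_one_sub_mul_self {n : ℕ} (u : Matrix.unitaryGroup (Fin n) ℂ) :
    ((1 - (u : Matrix (Fin n) (Fin n) ℂ))ᴴ * (1 - (u : Matrix (Fin n) (Fin n) ℂ))).trace.re =
      2 * (n - (u : Matrix (Fin n) (Fin n) ℂ).trace.re) := by
  have h : (u : Matrix (Fin n) (Fin n) ℂ)ᴴ * (u : Matrix (Fin n) (Fin n) ℂ) = 1 :=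
    Matrix.mem_unitaryGroup_iff'.mp u.2
  rw [Matrix.conjTranspose_sub, Matrix.conjTranspose_one, sub_mul, mul_sub, mul_sub, h]
  simp [Matrix.trace_conjTranspose]
  ring

theorem eq_one_of_le_trace_re {n : ℕ} {u : Matrix.unitaryGroup (Fin n) ℂ}
    (hu : (n : ℝ) ≤ (u : Matrix (Fin n) (Fin n) ℂ).trace.re) : u = 1 := by
  have hpos := (Matrix.posSemidef_conjTranspose_mul_self
    (1 - (u : Matrix (Fin n) (Fin n) ℂ))).trace_nonneg
  have hre := trace_conjTranspose_one_sub_mul_self u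
  have hzero : ((1 - (u : Matrix (Fin n) (Fin n) ℂ))ᴴ *
      (1 - (u : Matrix (Fin n) (Fin n) ℂ))).trace = 0 := by
    rw [Complex.nonneg_iff] at hpos
    refine Complex.ext ?_ hpos.2.symm
    rw [Complex.zero_re]
    linarith [hpos.1]
  rw [Matrix.trace_conjTranspose_mul_self_eq_zero_iff, sub_eq_zero] at hzero
  exact Subtype.ext hzero.symm

variable [Group K]

theorem URepEquiv.trace_eq {n : ℕ} {π ρ : K →* Matrix.unitaryGroup (Fin n) ℂ}
    (h : URepEquiv π ρ) (x : K) :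
    (π x : Matrix (Fin n) (Fin n) ℂ).trace = (ρ x : Matrix (Fin n) (Fin n) ℂ).trace := by
  obtain ⟨U, hU⟩ := h
  have hUU : (U : Matrix (Fin n) (Fin n) ℂ) * (U : Matrix (Fin n) (Fin n) ℂ)ᴴ = 1 :=
    Matrix.mem_unitaryGroup_iff.mp U.2
  have hUU' : (U : Matrix (Fin n) (Fin n) ℂ)ᴴ * (U : Matrix (Fin n) (Fin n) ℂ) = 1 :=
    Matrix.mem_unitaryGroup_iff'.mp U.2
  rw [← mul_one (ρ x : Matrix (Fin n) (Fin n) ℂ), ← hUU, ← mul_assoc, ← hU, mul_assoc,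
    Matrix.trace_mul_comm, mul_assoc, hUU', mul_one]

variable [TopologicalSpace K]

/-- A finite orbit of representation classes has only finitely many characters. -/
theorem finite_characters_of_finite_repOrbit {n : ℕ} {Γ : Subgroup ↥(ContAut K)}
    {π : K →* Matrix.unitaryGroup (Fin n) ℂ}
    (h : (repOrbit (Γ : Set ↥(ContAut K)) π).Finite) :
    ((fun (δ : ↥(ContAut K)) (x : K) =>
      (π ((δ : MulAut K) x) : Matrix (Fin n) (Fin n) ℂ).trace) '' Γ).Finite := by
  let character : Quot (URepEquiv (K := K) (n := n)) → K → ℂ :=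
    Quot.lift (fun ρ x => (ρ x : Matrix (Fin n) (Fin n) ℂ).trace)
      fun _ _ hρ => funext hρ.trace_eq
  refine (h.image character).subset ?_
  rintro _ ⟨δ, hδ, rfl⟩
  exact ⟨_, ⟨δ⁻¹, Γ.inv_mem hδ, rfl⟩, rfl⟩

/-- If `Γ = Γ₁Γ₂` is ergodic, a representation with `Γ₁`-invariant character and finite
`Γ₂`-orbit is trivial. -/
theorem ErgSet.eq_one_of_trace_invariant [MeasurableSpace K] [BorelSpace K] {μ : Measure K}
    [IsProbabilityMeasure μ] [μ.IsOpenPosMeasure] {Γ Γ₁ Γ₂ : Subgroup ↥(ContAut K)}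
    (hΓ : ErgSet μ (Γ : Set ↥(ContAut K)))
    (hprod : (Γ : Set ↥(ContAut K)) = (Γ₁ : Set ↥(ContAut K)) * (Γ₂ : Set ↥(ContAut K)))
    {n : ℕ} {π : K →* Matrix.unitaryGroup (Fin n) ℂ} (hπ : Continuous π)
    (hfin : (repOrbit (Γ₂ : Set ↥(ContAut K)) π).Finite)
    (htr : ∀ α ∈ Γ₁, ∀ x, (π ((α : MulAut K) x) : Matrix (Fin n) (Fin n) ℂ).trace =
      (π x : Matrix (Fin n) (Fin n) ℂ).trace) (x : K) : π x = 1 := by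
  let χ : ↥(ContAut K) → K → ℂ := fun δ y =>
    (π ((δ : MulAut K) y) : Matrix (Fin n) (Fin n) ℂ).trace
  have hχ : ∀ δ, Continuous (χ δ) := fun δ =>
    (continuous_subtype_val.comp (hπ.comp (ContAut.continuous δ))).matrix_trace
  refine eq_one_of_le_trace_re (le_of_forall_lt fun c hc => ?_)
  obtain ⟨d, hcd, hdn⟩ := exists_between hc
  let A : Set K := ⋃ γ ∈ Γ, {y | (χ γ y).re < d}
  have hA : IsOpen A := isOpen_biUnion fun γ _ =>
    isOpen_lt (Complex.continuous_re.comp (hχ γ)) continuous_const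
  have hsub : ∀ α ∈ Γ, ∀ y, (α : MulAut K) y ∈ A → y ∈ A := fun α hα y hy => by
    obtain ⟨γ, hγ, hy⟩ := mem_iUnion₂.mp hy
    exact mem_iUnion₂.mpr ⟨γ * α, Γ.mul_mem hγ hα, hy⟩
  have hinv : ∀ α ∈ (Γ : Set ↥(ContAut K)), (α : MulAut K) '' A = A := fun α hα => by
    ext y
    constructor
    · rintro ⟨z, hz, rfl⟩
      exact hsub α⁻¹ (Γ.inv_mem hα) _ (by simpa using hz)
    · exact fun hy => ⟨(α : MulAut K).symm y, hsub α hα _ (by simpa using hy), by simp⟩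
  have hone : ∀ᶠ y in 𝓝 (1 : K), y ∈ Aᶜ := by
    have : ∀ᶠ y in 𝓝 (1 : K), ∀ φ ∈ χ '' (Γ₂ : Set ↥(ContAut K)), d < (φ y).re := by
      refine (Filter.eventually_all_finite (finite_characters_of_finite_repOrbit hfin)).mpr ?_
      rintro _ ⟨δ, -, rfl⟩
      exact (Complex.continuous_re.comp (hχ δ)).continuousAt.eventually_const_lt
        (by simpa [χ] using hdn)
    filter_upwards [this] with y hy hyA
    obtain ⟨γ, hγ, hγy⟩ := mem_iUnion₂.mp hyA
    obtain ⟨γ₁, hγ₁, γ₂, hγ₂, rfl⟩ := Set.mem_mul.mp (hprod.subset hγ)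
    have hlt : (χ γ₂ y).re < d := by
      rwa [← show χ (γ₁ * γ₂) y = χ γ₂ y from htr γ₁ hγ₁ _]
    exact lt_asymm hlt (hy _ ⟨γ₂, hγ₂, rfl⟩)
  have hA1 : μ A ≠ 1 := fun h =>
    (Measure.measure_pos_of_mem_nhds μ hone).ne' ((prob_compl_eq_zero_iff hA.measurableSet).mpr h)
  have hempty : A = ∅ :=
    (hA.measure_eq_zero_iff μ).mp ((hΓ A hA.measurableSet hinv).resolve_right hA1)
  by_contra! h
  have : x ∈ A := mem_iUnion₂.mpr ⟨1, Γ.one_mem, h.trans_lt hcd⟩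
  simp [hempty] at this

end Ergodicity

/-- Lemma 2.4. Let `Γ₁, Γ₂` be subgroups of a group `Γ` of continuous
automorphisms of a compact metrizable group `K`, with `Γ₂` normal in `Γ`, `Γ₂` compact in
the compact-open topology, and `Γ = Γ₁Γ₂`. Then (i) every orbit of the dual action of `Γ₂`
on classes of irreducible finite-dimensional unitary representations is finite, and
(ii) `Γ` is ergodic on `K` iff `Γ₁` is ergodic on `K`. -/
theorem statement3 {K : Type*} [Group K] [TopologicalSpace K] [IsTopologicalGroup K]
    [CompactSpace K] [TopologicalSpace.MetrizableSpace K]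
    [MeasurableSpace K] [BorelSpace K]
    (μ : Measure K) [μ.IsHaarMeasure] [IsProbabilityMeasure μ]
    (Γ Γ₁ Γ₂ : Subgroup ↥(ContAut K))
    (h1 : Γ₁ ≤ Γ) (h2 : Γ₂ ≤ Γ)
    (hnormal : ∀ γ ∈ Γ, ∀ δ ∈ Γ₂, γ * δ * γ⁻¹ ∈ Γ₂)
    (hcompact : IsCompact ((fun α : ↥(ContAut K) =>
      (⟨⇑(α : MulAut K), ContAut.continuous α⟩ : C(K, K))) '' (Γ₂ : Set ↥(ContAut K))))
    (hprod : (Γ : Set ↥(ContAut K)) = (Γ₁ : Set ↥(ContAut K)) * (Γ₂ : Set ↥(ContAut K))) :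
    (∀ (n : ℕ) (π : K →* Matrix.unitaryGroup (Fin n) ℂ), Continuous π → IsIrredRep π →
      (repOrbit (Γ₂ : Set ↥(ContAut K)) π).Finite)
    ∧ (ErgSet μ (Γ : Set ↥(ContAut K)) ↔ ErgSet μ (Γ₁ : Set ↥(ContAut K))) := by
  let _ := TopologicalSpace.metrizableSpaceMetric K
  have horbit := fun (n : ℕ) (π : K →* Matrix.unitaryGroup (Fin n) ℂ) (hπ : Continuous π) =>
    finite_repOrbit μ Γ₂ hcompact hπ
  refine ⟨fun n π hπ _ => horbit n π hπ, fun hΓ => ?_,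
    fun hΓ₁ A hA hinv => hΓ₁ A hA fun α hα => hinv α (h1 hα)⟩
  by_contra hΓ₁
  obtain ⟨n, π, hπ, ⟨x, hx⟩, htr⟩ := exists_rep_trace_invariant_of_not_ergSet μ Γ₁ hΓ₁
  exact hx (hΓ.eq_one_of_trace_invariant hprod hπ (horbit n π hπ) htr x)

end ErgZd
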